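/- arXiv:2203.02992 — 8 statements merged into one kernel-verified Lean document; each statement's English description precedes it below -/
import Mathlib

section
/- Let Π be a color-counting 1-locally checkable problem with input graph G and let e_G be a clique-width k-expression of G. Let N_0 ∈ {0,...,𝒩}^{k×q} be the matrix all of whose entries are 0. Then the minimum weight of a proper coloring of G equals the minimum of λ(e_G, C, N_0) over all matrices C ∈ {0,...,𝒩}^{k×q} such that C[i,a] = 0 for every label i ∈ ℓ̄(e_G) and every color a ∈ Colors. -/
open Finset
open scoped Classical

noncomputable section

/-- A vertex-labeled graph with boolean adjacency and vertex labels in `Fin k`. -/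
structure LabGraph (V : Type) (k : ℕ) where
  verts : Finset V
  adj : V → V → Bool
  lab : V → Fin k

/-- Clique-width expressions with labels in `Fin k` over vertex type `V`:
creation `node i v` of a new vertex `v` with label `i`, disjoint union `union`,
join `η_{i,j}` and relabeling `ρ_{i→j}`. -/
inductive CW (V : Type) (k : ℕ) where
  | node (i : Fin k) (v : V)
  | union (e₁ e₂ : CW V k)
  | join (i j : Fin k) (e : CW V k)
  | relabel (i j : Fin k) (e : CW V k)

variable {V : Type} [Fintype V] [DecidableEq V] {k : ℕ}

/-- The labeled graph `G_e` constructed by a clique-width expression `e`. -/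
def CW.sem : CW V k → LabGraph V k
  | .node i v => ⟨{v}, fun _ _ => false, fun _ => i⟩
  | .union e₁ e₂ =>
      ⟨e₁.sem.verts ∪ e₂.sem.verts,
       fun u w => e₁.sem.adj u w || e₂.sem.adj u w,
       fun v => if v ∈ e₁.sem.verts then e₁.sem.lab v else e₂.sem.lab v⟩
  | .join i j e =>
      ⟨e.sem.verts,
       fun u w => e.sem.adj u w ||
         (decide (u ∈ e.sem.verts) && decide (w ∈ e.sem.verts) && decide (u ≠ w) &&
          ((decide (e.sem.lab u = i) && decide (e.sem.lab w = j)) ||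
           (decide (e.sem.lab u = j) && decide (e.sem.lab w = i)))),
       e.sem.lab⟩
  | .relabel i j e =>
      ⟨e.sem.verts, e.sem.adj, fun v => if e.sem.lab v = i then j else e.sem.lab v⟩

/-- Well-formedness of a clique-width expression: disjoint unions are over disjoint
vertex sets, joins and relabelings use two distinct labels, and a relabeling
`ρ_{i→j}(e)` is only applied when `j ∉ ℓ̄(e)`, i.e. some vertex of `G_e` has label `j`. -/
def CW.wf : CW V k → Prop
  | .node _ _ => True
  | .union e₁ e₂ => e₁.wf ∧ e₂.wf ∧ Disjoint e₁.sem.verts e₂.sem.verts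
  | .join i j e => i ≠ j ∧ e.wf
  | .relabel i j e => i ≠ j ∧ (∃ v ∈ e.sem.verts, e.sem.lab v = j) ∧ e.wf

/-- Irredundancy: whenever a join `η_{i,j}` is applied, there are no already existing
edges between vertices with label `i` and vertices with label `j`. -/
def CW.irred : CW V k → Prop
  | .node _ _ => True
  | .union e₁ e₂ => e₁.irred ∧ e₂.irred
  | .join i j e => e.irred ∧
      ∀ u w, e.sem.adj u w = true → ¬(e.sem.lab u = i ∧ e.sem.lab w = j)
  | .relabel _ _ e => e.irred

/-- `CW.Sub e' e` means that `e'` is a subexpression of `e`. -/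
inductive CW.Sub : CW V k → CW V k → Prop
  | refl (e : CW V k) : CW.Sub e e
  | unionL {e e₁ : CW V k} (e₂ : CW V k) : CW.Sub e e₁ → CW.Sub e (.union e₁ e₂)
  | unionR (e₁ : CW V k) {e e₂ : CW V k} : CW.Sub e e₂ → CW.Sub e (.union e₁ e₂)
  | join (i j : Fin k) {e e' : CW V k} : CW.Sub e e' → CW.Sub e (.join i j e')
  | relabel (i j : Fin k) {e e' : CW V k} : CW.Sub e e' → CW.Sub e (.relabel i j e')

/-- The data of a color-counting 1-locally checkable problem with colors `Fin q`
on vertex type `V` and weight set `W` (with order `≤`, maximum element `err`,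
operation `op` with neutral element `neutral`, `err` absorbing, `op` monotone). -/
structure LCP (V : Type) (q : ℕ) (W : Type) [LinearOrder W] where
  /-- the maximum element `Error` -/
  err : W
  le_err : ∀ s : W, s ≤ err
  /-- the operation `⊛` -/
  op : W → W → W
  op_comm : ∀ a b, op a b = op b a
  op_assoc : ∀ a b c, op (op a b) c = op a (op b c)
  /-- the neutral element of `⊛` -/
  neutral : W
  op_neutral : ∀ a, op a neutral = a
  op_err : ∀ a, op a err = err
  op_mono : ∀ a b c, a ≤ b → op a c ≤ op b c
  /-- the set `L_v` of possible colors of each vertex -/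
  L : V → Finset (Fin q)
  L_nonempty : ∀ v, (L v).Nonempty
  /-- the weights `w_{v,a}` -/
  wt : V → Fin q → W
  wt_ne_err : ∀ v a, a ∈ L v → wt v a ≠ err
  /-- the color-counting check function -/
  check : V → Fin q → (Fin q → ℕ) → Bool

variable {W : Type} [LinearOrder W] {q : ℕ}

/-- The weight `w(c) = ⊛_{v ∈ S} w_{v,c(v)}` of a coloring on a vertex set `S`. -/
def LCP.weight (P : LCP V q W) (S : Finset V) (c : V → Fin q) : W :=
  (S.toList.map fun v => P.wt v (c v)).foldr P.op P.neutral

/-- The minimum of `f` over the finite set `S`, and `d` if `S` is empty. -/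
def finMin {α : Type} (S : Finset α) (f : α → W) (d : W) : W :=
  if h : S.Nonempty then S.inf' h f else d

/-- Matrices in `{0,...,𝓝}^{k×q}`. -/
abbrev Mat (k q 𝓝 : ℕ) := Fin k → Fin q → Fin (𝓝 + 1)

/-- `c` is a `(C,N)`-coloring of `G_e`: a valid coloring satisfying (C1) and (C2). -/
def IsCN (P : LCP V q W) (𝓝 : ℕ) (e : CW V k) (C N : Mat k q 𝓝) (c : V → Fin q) : Prop :=
  (∀ v ∈ e.sem.verts, c v ∈ P.L v) ∧
  (∀ (i : Fin k) (a : Fin q),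
    min 𝓝 (e.sem.verts.filter fun v => c v = a ∧ e.sem.lab v = i).card = (C i a : ℕ)) ∧
  (∀ v ∈ e.sem.verts,
    P.check v (c v) (fun j =>
      min 𝓝 ((N (e.sem.lab v) j : ℕ) +
        (e.sem.verts.filter fun u => e.sem.adj v u = true ∧ c u = j).card)) = true)

/-- `λ(e,C,N)`: minimum weight of a `(C,N)`-coloring of `G_e`, `Error` if none exists. -/
def lambda (P : LCP V q W) (𝓝 : ℕ) (e : CW V k) (C N : Mat k q 𝓝) : W :=
  finMin (univ.filter fun c : V → Fin q => IsCN P 𝓝 e C N c) (P.weight e.sem.verts) P.err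

/-- `c` is a proper coloring of `G_e`. -/
def IsProper (P : LCP V q W) (e : CW V k) (c : V → Fin q) : Prop :=
  (∀ v ∈ e.sem.verts, c v ∈ P.L v) ∧
  (∀ v ∈ e.sem.verts,
    P.check v (c v)
      (fun j => (e.sem.verts.filter fun u => e.sem.adj v u = true ∧ c u = j).card) = true)

theorem finMin_le_of_mem {α : Type} (S : Finset α) (f : α → W) (d : W) {x : α} (hx : x ∈ S) :
    finMin S f d ≤ f x := by
  unfold finMin
  rw [dif_pos ⟨x, hx⟩]
  exact Finset.inf'_le f hx

theorem le_finMin_of {α : Type} (S : Finset α) (f : α → W) (d y : W) (hd : y ≤ d)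
    (h : ∀ x ∈ S, y ≤ f x) : y ≤ finMin S f d := by
  unfold finMin
  split_ifs with hS
  · exact Finset.le_inf' hS f h
  · exact hd

/-- The minimum weight of a proper coloring of `G = G_{e_G}` equals the
minimum of `λ(e_G, C, N₀)` over all matrices `C ∈ {0,...,𝓝}^{k×q}` with `C[i,a] = 0`
for every label `i ∈ ℓ̄(e_G)` and every color `a`, where `N₀` is the all-zero matrix. -/
theorem statement0 (P : LCP V q W) (eG : CW V k) (hwf : eG.wf)
    (𝓝 : ℕ) (h𝓝₁ : 1 ≤ 𝓝) (h𝓝₂ : 𝓝 ≤ eG.sem.verts.card)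
    (hstable : ∀ (v : V) (a : Fin q) (n : Fin q → ℕ),
      P.check v a n = P.check v a fun j => min 𝓝 (n j)) :
    finMin (univ.filter fun c : V → Fin q => IsProper P eG c) (P.weight eG.sem.verts) P.err
      =
    finMin (univ.filter fun C : Mat k q 𝓝 =>
        ∀ (i : Fin k) (a : Fin q), (∀ v ∈ eG.sem.verts, eG.sem.lab v ≠ i) → (C i a : ℕ) = 0)
      (fun C => lambda P 𝓝 eG C fun _ _ => (0 : Fin (𝓝 + 1))) P.err := by
  have key : ∀ (C : Mat k q 𝓝) (c : V → Fin q),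
      IsCN P 𝓝 eG C (fun _ _ => (0 : Fin (𝓝 + 1))) c ↔
        IsProper P eG c ∧ ∀ (i : Fin k) (a : Fin q),
          min 𝓝 (eG.sem.verts.filter fun v => c v = a ∧ eG.sem.lab v = i).card = (C i a : ℕ) := by
    intro C c
    unfold IsCN IsProper
    have h : ∀ v, P.check v (c v) (fun j =>
        min 𝓝 (((0 : Fin (𝓝 + 1)) : ℕ) +
          (eG.sem.verts.filter fun u => eG.sem.adj v u = true ∧ c u = j).card)) =
        P.check v (c v)
          (fun j => (eG.sem.verts.filter fun u => eG.sem.adj v u = true ∧ c u = j).card) := by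
      intro v
      rw [hstable v (c v) (fun j =>
        (eG.sem.verts.filter fun u => eG.sem.adj v u = true ∧ c u = j).card)]
      simp only [Fin.val_zero, Nat.zero_add]
    simp only [h]
    tauto
  apply le_antisymm
  · apply le_finMin_of _ _ _ _ (P.le_err _)
    intro C _
    apply le_finMin_of _ _ _ _ (P.le_err _)
    intro c hc
    apply finMin_le_of_mem
    rw [Finset.mem_filter] at hc ⊢
    exact ⟨Finset.mem_univ _, ((key C c).1 hc.2).1⟩
  · apply le_finMin_of _ _ _ _ (P.le_err _)
    intro c hc
    rw [Finset.mem_filter] at hc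
    let C : Mat k q 𝓝 := fun i a =>
      ⟨min 𝓝 (eG.sem.verts.filter fun v => c v = a ∧ eG.sem.lab v = i).card,
        Nat.lt_succ_of_le (min_le_left _ _)⟩
    refine le_trans (finMin_le_of_mem _ _ _ (x := C) ?_) ?_
    · rw [Finset.mem_filter]
      refine ⟨Finset.mem_univ _, fun i a hi => ?_⟩
      have h0 : (eG.sem.verts.filter fun v => c v = a ∧ eG.sem.lab v = i) = ∅ :=
        Finset.filter_eq_empty_iff.2 fun v hv h => hi v hv h.2
      simp only [C, h0, Finset.card_empty, Nat.min_zero]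
    · apply finMin_le_of_mem
      rw [Finset.mem_filter]
      exact ⟨Finset.mem_univ _, (key C c).2 ⟨hc.2, fun _ _ => rfl⟩⟩
end
end

section
/- Let i(v) be a subexpression of e_G (creating the new vertex v with label i) and let C, N ∈ {0,...,𝒩}^{k×q}. If there exists a color a ∈ L_v such that C[i,a] = 1 and C[j,b] = 0 for all other entries [j,b] of C, and moreover check(v, a, N[i,a_1], ..., N[i,a_q]) is True, then λ(i(v), C, N) = w_{v,a}. Otherwise, λ(i(v), C, N) = Error. -/
open Finset
open scoped Classical

noncomputable section

variable {V : Type} [Fintype V] [DecidableEq V] {k : ℕ}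

variable {W : Type} [LinearOrder W] {q : ℕ}

/-- Characterization of `(C,N)`-colorings of a single vertex graph. -/
theorem isCN_node_iff (P : LCP V q W) (𝓝 : ℕ) (h𝓝₁ : 1 ≤ 𝓝) (i : Fin k) (v : V)
    (C N : Mat k q 𝓝) (c : V → Fin q) :
    IsCN P 𝓝 (.node i v) C N c ↔
      c v ∈ P.L v ∧ (∀ (j : Fin k) (b : Fin q),
        (C j b : ℕ) = if j = i ∧ b = c v then 1 else 0) ∧
      P.check v (c v) (fun j => (N i j : ℕ)) = true := by
  have h2 : ∀ j, min 𝓝 (N i j : ℕ) = (N i j : ℕ) := fun j =>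
    min_eq_right (Nat.lt_succ_iff.mp (N i j).isLt)
  have hv : ∀ u, u ∈ (CW.node i v : CW V k).sem.verts ↔ u = v := fun u =>
    Finset.mem_singleton
  have hl : ∀ u, (CW.node i v : CW V k).sem.lab u = i := fun _ => rfl
  have ha : ∀ u w, (CW.node i v : CW V k).sem.adj u w = false := fun _ _ => rfl
  unfold IsCN
  generalize (CW.node i v : CW V k).sem = G at hv hl ha
  have hG : G.verts = {v} := by
    ext u
    rw [hv, Finset.mem_singleton]
  have h1 : ∀ (j : Fin k) (b : Fin q),
      min 𝓝 (G.verts.filter fun u => c u = b ∧ G.lab u = j).card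
        = if j = i ∧ b = c v then 1 else 0 := by
    intro j b
    rw [hG, Finset.filter_singleton, hl]
    by_cases h : c v = b ∧ i = j
    · rw [if_pos h, if_pos ⟨h.2.symm, h.1.symm⟩]
      simpa using h𝓝₁
    · rw [if_neg h, if_neg (fun h' => h ⟨h'.2.symm, h'.1.symm⟩)]
      simp
  simp only [h1]
  simp only [hv, forall_eq, hl, ha, Bool.false_eq_true, false_and,
    Finset.filter_false, Finset.card_empty, add_zero, h2]
  exact and_congr Iff.rfl (and_congr (forall₂_congr fun j b => eq_comm) Iff.rfl)

theorem weight_singleton (P : LCP V q W) (v : V) (c : V → Fin q) :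
    P.weight {v} c = P.wt v (c v) := by
  simp [LCP.weight, P.op_neutral]

/-- creating a new vertex `i(v)`. If there is a color `a ∈ L_v` with
`C[i,a] = 1`, all other entries of `C` zero, and `check(v, a, N[i,a_1], ..., N[i,a_q])`
true, then `λ(i(v), C, N) = w_{v,a}`; otherwise `λ(i(v), C, N) = Error`. -/
theorem statement1 (P : LCP V q W) (eG : CW V k) (hwf : eG.wf)
    (𝓝 : ℕ) (h𝓝₁ : 1 ≤ 𝓝) (h𝓝₂ : 𝓝 ≤ eG.sem.verts.card)
    (hstable : ∀ (v : V) (a : Fin q) (n : Fin q → ℕ),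
      P.check v a n = P.check v a fun j => min 𝓝 (n j))
    (i : Fin k) (v : V) (hsub : CW.Sub (.node i v) eG)
    (C N : Mat k q 𝓝) :
    (∀ a : Fin q, a ∈ P.L v →
      (C i a : ℕ) = 1 →
      (∀ (j : Fin k) (b : Fin q), ¬(j = i ∧ b = a) → (C j b : ℕ) = 0) →
      P.check v a (fun j => (N i j : ℕ)) = true →
      lambda P 𝓝 (.node i v) C N = P.wt v a) ∧
    ((¬∃ a : Fin q, a ∈ P.L v ∧ (C i a : ℕ) = 1 ∧
        (∀ (j : Fin k) (b : Fin q), ¬(j = i ∧ b = a) → (C j b : ℕ) = 0) ∧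
        P.check v a (fun j => (N i j : ℕ)) = true) →
      lambda P 𝓝 (.node i v) C N = P.err) := by
  constructor
  · intro a ha hC hC0 hck
    have hmem : (fun _ => a) ∈
        univ.filter fun c : V → Fin q => IsCN P 𝓝 (.node i v) C N c := by
      rw [Finset.mem_filter, isCN_node_iff P 𝓝 h𝓝₁]
      refine ⟨Finset.mem_univ _, ha, fun j b => ?_, hck⟩
      split_ifs with h
      · rw [h.1, h.2, hC]
      · exact hC0 j b h
    have hne : (univ.filter fun c : V → Fin q => IsCN P 𝓝 (.node i v) C N c).Nonempty :=
      ⟨_, hmem⟩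
    have hw : ∀ c ∈ univ.filter fun c : V → Fin q => IsCN P 𝓝 (.node i v) C N c,
        P.weight (CW.node i v : CW V k).sem.verts c = P.wt v a := by
      intro c hc
      rw [Finset.mem_filter, isCN_node_iff P 𝓝 h𝓝₁] at hc
      have h := hc.2.2.1 i a
      rw [hC] at h
      have hca : a = c v := by
        by_contra hne
        simp [hne] at h
      rw [hca]
      exact weight_singleton P v c
    unfold lambda finMin
    rw [dif_pos hne]
    apply le_antisymm
    · exact (Finset.inf'_le _ hmem).trans (hw _ hmem).le
    · exact Finset.le_inf' _ _ fun c hc => (hw c hc).ge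
  · intro hno
    unfold lambda finMin
    rw [dif_neg]
    rintro ⟨c, hc⟩
    rw [Finset.mem_filter, isCN_node_iff P 𝓝 h𝓝₁] at hc
    obtain ⟨-, h1, h2, h3⟩ := hc
    refine hno ⟨c v, h1, ?_, fun j b h => ?_, h3⟩
    · rw [h2]; simp
    · rw [h2, if_neg h]
end
end

section
/- Let e_1 ⊕ e_2 be a subexpression of e_G and let C, N ∈ {0,...,𝒩}^{k×q}. Let N_1, N_2 ∈ {0,...,𝒩}^{k×q} be defined by: N_1[i,a] = 0 for every label i ∈ ℓ̄(e_1) and every color a ∈ Colors, N_1[i,a] = N[i,a] for every label i ∉ ℓ̄(e_1) and every color a ∈ Colors, and N_2 defined analogously with respect to e_2. Then λ(e_1 ⊕ e_2, C, N) equals the minimum of λ(e_1, C_1, N_1) ⊛ λ(e_2, C_2, N_2) over all matrices C_1, C_2 ∈ {0,...,𝒩}^{k×q} such that: C_1[i,a] = 0 for all i ∈ ℓ̄(e_1) and a ∈ Colors; C_2[i,a] = 0 for all i ∈ ℓ̄(e_2) and a ∈ Colors; and C[i,a] = min(𝒩, C_1[i,a] + C_2[i,a]) for all i ∈ {1,...,k}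 and a ∈ Colors. -/
open Finset
open scoped Classical

noncomputable section

variable {V : Type} [Fintype V] [DecidableEq V] {k : ℕ}

variable {W : Type} [LinearOrder W] {q : ℕ}

theorem finMin_le_aux {α : Type} (S : Finset α) (f : α → W) (d : W) (s : α) (hs : s ∈ S) :
    finMin S f d ≤ f s := by
  unfold finMin
  rw [dif_pos ⟨s, hs⟩]
  exact Finset.inf'_le f hs

theorem finMin_cases_aux {α : Type} (S : Finset α) (f : α → W) (d : W) :
    finMin S f d = d ∨ ∃ s ∈ S, finMin S f d = f s := by
  unfold finMin
  by_cases h : S.Nonempty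
  · rw [dif_pos h]
    exact Or.inr (Finset.exists_mem_eq_inf' h f)
  · rw [dif_neg h]
    exact Or.inl rfl

theorem CW.adj_mem_aux (e : CW V k) : ∀ u w, e.sem.adj u w = true →
    u ∈ e.sem.verts ∧ w ∈ e.sem.verts := by
  induction e with
  | node i v => intro u w h; simp [CW.sem] at h
  | union e₁ e₂ ih₁ ih₂ =>
    intro u w h
    simp only [CW.sem, Bool.or_eq_true, Finset.mem_union] at h ⊢
    rcases h with h | h
    · exact ⟨Or.inl (ih₁ u w h).1, Or.inl (ih₁ u w h).2⟩
    · exact ⟨Or.inr (ih₂ u w h).1, Or.inr (ih₂ u w h).2⟩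
  | join i j e ih =>
    intro u w h
    simp only [CW.sem, Bool.or_eq_true, Bool.and_eq_true, decide_eq_true_eq] at h ⊢
    rcases h with h | h
    · exact ih u w h
    · exact h.1.1
  | relabel i j e ih =>
    intro u w h
    exact ih u w h

theorem CW.wf_sub_aux {e e' : CW V k} (h : CW.Sub e e') : e'.wf → e.wf := by
  induction h with
  | refl e => exact id
  | unionL e₂ _ ih => exact fun h => ih h.1
  | unionR e₁ _ ih => exact fun h => ih h.2.1
  | join i j _ ih => exact fun h => ih h.2
  | relabel i j _ ih => exact fun h => ih h.2.2

theorem LCP.weight_congr_aux (P : LCP V q W) (S : Finset V) (c c' : V → Fin q)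
    (h : ∀ v ∈ S, c v = c' v) : P.weight S c = P.weight S c' := by
  unfold LCP.weight
  congr 1
  apply List.map_congr_left
  intro v hv
  rw [h v (Finset.mem_toList.1 hv)]

theorem LCP.weight_union_aux (P : LCP V q W) (A B : Finset V) (hAB : Disjoint A B)
    (c : V → Fin q) : P.weight (A ∪ B) c = P.op (P.weight A c) (P.weight B c) := by
  have : Std.Commutative P.op := ⟨P.op_comm⟩
  have : Std.Associative P.op := ⟨P.op_assoc⟩
  have key : ∀ S : Finset V, P.weight S c = S.fold P.op P.neutral (fun v => P.wt v (c v)) := by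
    intro S
    unfold LCP.weight Finset.fold
    rw [← Finset.coe_toList S, Multiset.map_coe, Multiset.coe_fold_r]
  have := Finset.fold_union_inter (op := P.op) (f := fun v => P.wt v (c v))
    (s₁ := A) (s₂ := B) (b₁ := P.neutral) (b₂ := P.neutral)
  rw [Finset.disjoint_iff_inter_eq_empty.1 hAB, Finset.fold_empty, P.op_neutral] at this
  rw [key, key, key, this]

theorem IsCN_congr_aux (P : LCP V q W) (𝓝 : ℕ) (e : CW V k) (C N : Mat k q 𝓝)
    (c c' : V → Fin q) (h : ∀ v ∈ e.sem.verts, c v = c' v) (hc : IsCN P 𝓝 e C N c) :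
    IsCN P 𝓝 e C N c' := by
  obtain ⟨h1, h2, h3⟩ := hc
  refine ⟨fun v hv => h v hv ▸ h1 v hv, fun i a => ?_, fun v hv => ?_⟩
  · rw [← h2 i a]
    congr 2
    apply Finset.filter_congr
    intro v hv
    rw [h v hv]
  · refine Eq.trans ?_ (h3 v hv)
    rw [h v hv]
    congr 1
    funext j
    congr 3
    apply Finset.filter_congr
    intro u hu
    rw [h u hu]

theorem IsCN_union_aux (P : LCP V q W) (𝓝 : ℕ) (e₁ e₂ : CW V k)
    (hd : Disjoint e₁.sem.verts e₂.sem.verts)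
    (C N N₁ N₂ C₁ C₂ : Mat k q 𝓝)
    (hN₁ : ∀ (i : Fin k) (a : Fin q),
      (∃ v ∈ e₁.sem.verts, e₁.sem.lab v = i) → N₁ i a = N i a)
    (hN₂ : ∀ (i : Fin k) (a : Fin q),
      (∃ v ∈ e₂.sem.verts, e₂.sem.lab v = i) → N₂ i a = N i a)
    (c : V → Fin q)
    (hC₁ : ∀ (i : Fin k) (a : Fin q),
      min 𝓝 (e₁.sem.verts.filter fun v => c v = a ∧ e₁.sem.lab v = i).card = (C₁ i a : ℕ))
    (hC₂ : ∀ (i : Fin k) (a : Fin q),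
      min 𝓝 (e₂.sem.verts.filter fun v => c v = a ∧ e₂.sem.lab v = i).card = (C₂ i a : ℕ)) :
    IsCN P 𝓝 (.union e₁ e₂) C N c ↔
      ((∀ (i : Fin k) (a : Fin q), (C i a : ℕ) = min 𝓝 ((C₁ i a : ℕ) + (C₂ i a : ℕ))) ∧
        IsCN P 𝓝 e₁ C₁ N₁ c ∧ IsCN P 𝓝 e₂ C₂ N₂ c) := by
  have hnot : ∀ v ∈ e₂.sem.verts, v ∉ e₁.sem.verts :=
    fun v hv hv' => Finset.disjoint_left.1 hd hv' hv
  have hlab₁ : ∀ v ∈ e₁.sem.verts, (CW.union e₁ e₂).sem.lab v = e₁.sem.lab v := by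
    intro v hv
    simp only [CW.sem]
    rw [if_pos hv]
  have hlab₂ : ∀ v ∈ e₂.sem.verts, (CW.union e₁ e₂).sem.lab v = e₂.sem.lab v := by
    intro v hv
    simp only [CW.sem]
    rw [if_neg (hnot v hv)]
  have hcount : ∀ (i : Fin k) (a : Fin q),
      ((CW.union e₁ e₂).sem.verts.filter
        fun v => c v = a ∧ (CW.union e₁ e₂).sem.lab v = i).card =
      (e₁.sem.verts.filter fun v => c v = a ∧ e₁.sem.lab v = i).card +
      (e₂.sem.verts.filter fun v => c v = a ∧ e₂.sem.lab v = i).card := by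
    intro i a
    have hv : (CW.union e₁ e₂).sem.verts = e₁.sem.verts ∪ e₂.sem.verts := by
      simp only [CW.sem]
    rw [hv, Finset.filter_union, Finset.card_union_of_disjoint
      (Finset.disjoint_filter_filter hd)]
    congr 2
    · apply Finset.filter_congr
      intro v hv
      rw [hlab₁ v hv]
    · apply Finset.filter_congr
      intro v hv
      rw [hlab₂ v hv]
  have hadj₁ : ∀ v ∈ e₁.sem.verts, ∀ j, ((CW.union e₁ e₂).sem.verts.filter
        fun u => (CW.union e₁ e₂).sem.adj v u = true ∧ c u = j) =
      (e₁.sem.verts.filter fun u => e₁.sem.adj v u = true ∧ c u = j) := by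
    intro v hv j
    ext u
    have a1 := e₁.adj_mem_aux v u
    have a2 := e₂.adj_mem_aux v u
    have a3 := hnot v
    simp only [CW.sem, Finset.mem_filter, Finset.mem_union, Bool.or_eq_true]
    tauto
  have hadj₂ : ∀ v ∈ e₂.sem.verts, ∀ j, ((CW.union e₁ e₂).sem.verts.filter
        fun u => (CW.union e₁ e₂).sem.adj v u = true ∧ c u = j) =
      (e₂.sem.verts.filter fun u => e₂.sem.adj v u = true ∧ c u = j) := by
    intro v hv j
    ext u
    have a1 := e₁.adj_mem_aux v u
    have a2 := e₂.adj_mem_aux v u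
    have a3 := hnot v
    simp only [CW.sem, Finset.mem_filter, Finset.mem_union, Bool.or_eq_true]
    tauto
  have hmem : ∀ v, v ∈ (CW.union e₁ e₂).sem.verts ↔ v ∈ e₁.sem.verts ∨ v ∈ e₂.sem.verts := by
    intro v
    simp only [CW.sem, Finset.mem_union]
  have hck₁ : ∀ v ∈ e₁.sem.verts,
      P.check v (c v) (fun j => min 𝓝 ((N ((CW.union e₁ e₂).sem.lab v) j : ℕ) +
        ((CW.union e₁ e₂).sem.verts.filter
          fun u => (CW.union e₁ e₂).sem.adj v u = true ∧ c u = j).card)) =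
      P.check v (c v) (fun j => min 𝓝 ((N₁ (e₁.sem.lab v) j : ℕ) +
        (e₁.sem.verts.filter fun u => e₁.sem.adj v u = true ∧ c u = j).card)) := by
    intro v hv
    congr 1
    funext j
    rw [hadj₁ v hv j, hlab₁ v hv, hN₁ _ _ ⟨v, hv, rfl⟩]
  have hck₂ : ∀ v ∈ e₂.sem.verts,
      P.check v (c v) (fun j => min 𝓝 ((N ((CW.union e₁ e₂).sem.lab v) j : ℕ) +
        ((CW.union e₁ e₂).sem.verts.filter
          fun u => (CW.union e₁ e₂).sem.adj v u = true ∧ c u = j).card)) =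
      P.check v (c v) (fun j => min 𝓝 ((N₂ (e₂.sem.lab v) j : ℕ) +
        (e₂.sem.verts.filter fun u => e₂.sem.adj v u = true ∧ c u = j).card)) := by
    intro v hv
    congr 1
    funext j
    rw [hadj₂ v hv j, hlab₂ v hv, hN₂ _ _ ⟨v, hv, rfl⟩]
  constructor
  · rintro ⟨h1, h2, h3⟩
    refine ⟨fun i a => ?_, ⟨fun v hv => h1 v ((hmem v).2 (Or.inl hv)), hC₁, fun v hv => ?_⟩,
      ⟨fun v hv => h1 v ((hmem v).2 (Or.inr hv)), hC₂, fun v hv => ?_⟩⟩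
    · have := h2 i a
      rw [hcount] at this
      have := hC₁ i a
      have := hC₂ i a
      omega
    · rw [← hck₁ v hv]
      exact h3 v ((hmem v).2 (Or.inl hv))
    · rw [← hck₂ v hv]
      exact h3 v ((hmem v).2 (Or.inr hv))
  · rintro ⟨h0, ⟨h1, -, h3⟩, ⟨h1', -, h3'⟩⟩
    refine ⟨fun v hv => ?_, fun i a => ?_, fun v hv => ?_⟩
    · rcases (hmem v).1 hv with hv | hv
      · exact h1 v hv
      · exact h1' v hv
    · rw [hcount]
      have := h0 i a
      have := hC₁ i a
      have := hC₂ i a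
      omega
    · rcases (hmem v).1 hv with hv | hv
      · rw [hck₁ v hv]
        exact h3 v hv
      · rw [hck₂ v hv]
        exact h3' v hv

theorem exists_count_aux (𝓝 : ℕ) (e : CW V k) (c : V → Fin q) :
    ∃ C : Mat k q 𝓝, (∀ (i : Fin k) (a : Fin q),
      min 𝓝 (e.sem.verts.filter fun v => c v = a ∧ e.sem.lab v = i).card = (C i a : ℕ)) ∧
      ∀ (i : Fin k) (a : Fin q),
        (∀ v ∈ e.sem.verts, e.sem.lab v ≠ i) → (C i a : ℕ) = 0 := by
  refine ⟨fun i a => ⟨min 𝓝 (e.sem.verts.filter fun v => c v = a ∧ e.sem.lab v = i).card,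
    by omega⟩, fun i a => rfl, fun i a h => ?_⟩
  have : (e.sem.verts.filter fun v => c v = a ∧ e.sem.lab v = i) = ∅ :=
    Finset.filter_eq_empty_iff.2 fun v hv hh => h v hv hh.2
  simp [this]

/-- disjoint union `e₁ ⊕ e₂`. With `N₁` equal to `N` on the labels used
by `e₁` and zero on `ℓ̄(e₁)` (and `N₂` analogous), `λ(e₁ ⊕ e₂, C, N)` is the minimum of
`λ(e₁,C₁,N₁) ⊛ λ(e₂,C₂,N₂)` over all `C₁, C₂ ∈ {0,...,𝓝}^{k×q}` with `C₁` zero on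
`ℓ̄(e₁)`, `C₂` zero on `ℓ̄(e₂)`, and `C[i,a] = min(𝓝, C₁[i,a] + C₂[i,a])` everywhere. -/
theorem statement2 (P : LCP V q W) (eG : CW V k) (hwf : eG.wf)
    (𝓝 : ℕ) (h𝓝₁ : 1 ≤ 𝓝) (h𝓝₂ : 𝓝 ≤ eG.sem.verts.card)
    (hstable : ∀ (v : V) (a : Fin q) (n : Fin q → ℕ),
      P.check v a n = P.check v a fun j => min 𝓝 (n j))
    (e₁ e₂ : CW V k) (hsub : CW.Sub (.union e₁ e₂) eG)
    (C N N₁ N₂ : Mat k q 𝓝)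
    (hN₁ : ∀ (i : Fin k) (a : Fin q),
      ((∀ v ∈ e₁.sem.verts, e₁.sem.lab v ≠ i) → (N₁ i a : ℕ) = 0) ∧
      ((∃ v ∈ e₁.sem.verts, e₁.sem.lab v = i) → N₁ i a = N i a))
    (hN₂ : ∀ (i : Fin k) (a : Fin q),
      ((∀ v ∈ e₂.sem.verts, e₂.sem.lab v ≠ i) → (N₂ i a : ℕ) = 0) ∧
      ((∃ v ∈ e₂.sem.verts, e₂.sem.lab v = i) → N₂ i a = N i a)) :
    lambda P 𝓝 (.union e₁ e₂) C N =
      finMin (univ.filter fun CC : Mat k q 𝓝 × Mat k q 𝓝 =>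
          (∀ (i : Fin k) (a : Fin q),
            (∀ v ∈ e₁.sem.verts, e₁.sem.lab v ≠ i) → (CC.1 i a : ℕ) = 0) ∧
          (∀ (i : Fin k) (a : Fin q),
            (∀ v ∈ e₂.sem.verts, e₂.sem.lab v ≠ i) → (CC.2 i a : ℕ) = 0) ∧
          (∀ (i : Fin k) (a : Fin q),
            (C i a : ℕ) = min 𝓝 ((CC.1 i a : ℕ) + (CC.2 i a : ℕ))))
        (fun CC => P.op (lambda P 𝓝 e₁ CC.1 N₁) (lambda P 𝓝 e₂ CC.2 N₂)) P.err := by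
  have hwf' := CW.wf_sub_aux hsub hwf
  have hd : Disjoint e₁.sem.verts e₂.sem.verts := hwf'.2.2
  have hverts : (CW.union e₁ e₂).sem.verts = e₁.sem.verts ∪ e₂.sem.verts := by
    simp only [CW.sem]
  apply le_antisymm
  · rcases finMin_cases_aux (univ.filter fun CC : Mat k q 𝓝 × Mat k q 𝓝 =>
          (∀ (i : Fin k) (a : Fin q),
            (∀ v ∈ e₁.sem.verts, e₁.sem.lab v ≠ i) → (CC.1 i a : ℕ) = 0) ∧
          (∀ (i : Fin k) (a : Fin q),
            (∀ v ∈ e₂.sem.verts, e₂.sem.lab v ≠ i) → (CC.2 i a : ℕ) = 0) ∧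
          (∀ (i : Fin k) (a : Fin q),
            (C i a : ℕ) = min 𝓝 ((CC.1 i a : ℕ) + (CC.2 i a : ℕ))))
        (fun CC => P.op (lambda P 𝓝 e₁ CC.1 N₁) (lambda P 𝓝 e₂ CC.2 N₂)) P.err
      with h | ⟨⟨C₁, C₂⟩, hCC, h⟩
    · rw [h]
      exact P.le_err _
    · rw [h]
      simp only [Finset.mem_filter, Finset.mem_univ, true_and] at hCC
      obtain ⟨-, -, hC⟩ := hCC
      rcases finMin_cases_aux (univ.filter fun c : V → Fin q => IsCN P 𝓝 e₁ C₁ N₁ c)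
        (P.weight e₁.sem.verts) P.err with h1 | ⟨c₁, hc₁, h1⟩
      · have h1' : lambda P 𝓝 e₁ C₁ N₁ = P.err := h1
        simp only [h1']
        rw [P.op_comm, P.op_err]
        exact P.le_err _
      rcases finMin_cases_aux (univ.filter fun c : V → Fin q => IsCN P 𝓝 e₂ C₂ N₂ c)
        (P.weight e₂.sem.verts) P.err with h2 | ⟨c₂, hc₂, h2⟩
      · have h2' : lambda P 𝓝 e₂ C₂ N₂ = P.err := h2
        simp only [h2']
        rw [P.op_err]
        exact P.le_err _
      have h1' : lambda P 𝓝 e₁ C₁ N₁ = P.weight e₁.sem.verts c₁ := h1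
      have h2' : lambda P 𝓝 e₂ C₂ N₂ = P.weight e₂.sem.verts c₂ := h2
      simp only [h1', h2']
      have hc₁ := (Finset.mem_filter.1 hc₁).2
      have hc₂ := (Finset.mem_filter.1 hc₂).2
      let c : V → Fin q := fun v => if v ∈ e₁.sem.verts then c₁ v else c₂ v
      have e1 : ∀ v ∈ e₁.sem.verts, c₁ v = c v := fun v hv => (if_pos hv).symm
      have e2 : ∀ v ∈ e₂.sem.verts, c₂ v = c v := fun v hv =>
        (if_neg (fun hv' => Finset.disjoint_left.1 hd hv' hv)).symm
      have k1 := IsCN_congr_aux P 𝓝 e₁ C₁ N₁ c₁ c e1 hc₁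
      have k2 := IsCN_congr_aux P 𝓝 e₂ C₂ N₂ c₂ c e2 hc₂
      have kk := (IsCN_union_aux P 𝓝 e₁ e₂ hd C N N₁ N₂ C₁ C₂ (fun i a => (hN₁ i a).2)
        (fun i a => (hN₂ i a).2) c k1.2.1 k2.2.1).2 ⟨hC, k1, k2⟩
      rw [P.weight_congr_aux _ c₁ c e1, P.weight_congr_aux _ c₂ c e2,
        ← P.weight_union_aux _ _ hd c, ← hverts]
      exact finMin_le_aux _ _ _ c (Finset.mem_filter.2 ⟨Finset.mem_univ _, kk⟩)
  · rcases finMin_cases_aux (univ.filter fun c : V → Fin q => IsCN P 𝓝 (.union e₁ e₂) C N c)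
        (P.weight (CW.union e₁ e₂).sem.verts) P.err with h | ⟨c, hc, h⟩
    · have h' : lambda P 𝓝 (.union e₁ e₂) C N = P.err := h
      rw [h']
      exact P.le_err _
    · have h' : lambda P 𝓝 (.union e₁ e₂) C N = P.weight (CW.union e₁ e₂).sem.verts c := h
      have hc := (Finset.mem_filter.1 hc).2
      obtain ⟨C₁, hC₁, hz₁⟩ := exists_count_aux 𝓝 e₁ c
      obtain ⟨C₂, hC₂, hz₂⟩ := exists_count_aux 𝓝 e₂ c
      obtain ⟨hC, k1, k2⟩ := (IsCN_union_aux P 𝓝 e₁ e₂ hd C N N₁ N₂ C₁ C₂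
        (fun i a => (hN₁ i a).2) (fun i a => (hN₂ i a).2) c hC₁ hC₂).1 hc
      rw [h', hverts, P.weight_union_aux _ _ hd c]
      refine le_trans (finMin_le_aux _ _ _ (C₁, C₂)
        (Finset.mem_filter.2 ⟨Finset.mem_univ _, hz₁, hz₂, hC⟩)) ?_
      have l1 : lambda P 𝓝 e₁ C₁ N₁ ≤ P.weight e₁.sem.verts c :=
        finMin_le_aux _ _ _ c (Finset.mem_filter.2 ⟨Finset.mem_univ _, k1⟩)
      have l2 : lambda P 𝓝 e₂ C₂ N₂ ≤ P.weight e₂.sem.verts c :=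
        finMin_le_aux _ _ _ c (Finset.mem_filter.2 ⟨Finset.mem_univ _, k2⟩)
      refine le_trans (P.op_mono _ _ _ l1) ?_
      rw [P.op_comm, P.op_comm (P.weight e₁.sem.verts c)]
      exact P.op_mono _ _ _ l2
end
end

section
/- Suppose e_G is an irredundant clique-width k-expression. Let η_{i,j}(e) be a subexpression of e_G and let C, N ∈ {0,...,𝒩}^{k×q}. Let N_e ∈ {0,...,𝒩}^{k×q} be defined by: N_e[i,a] = min(𝒩, N[i,a] + C[j,a]) for every a ∈ Colors; N_e[j,a] = min(𝒩, N[j,a] + C[i,a]) for every a ∈ Colors; and N_e[h,a] = N[h,a] for every h ∈ {1,...,k} ∖ {i,j} and every a ∈ Colors. Then λ(η_{i,j}(e), C, N) = λ(e, C, N_e). -/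
open Finset
open scoped Classical

noncomputable section

variable {V : Type} [Fintype V] [DecidableEq V] {k : ℕ}

variable {W : Type} [LinearOrder W] {q : ℕ}

theorem CW.adj_symm (e : CW V k) : ∀ u w, e.sem.adj u w = true → e.sem.adj w u = true := by
  induction e with
  | node i v => intro u w h; simp [CW.sem] at h
  | union e₁ e₂ h₁ h₂ =>
    intro u w h
    simp only [CW.sem, Bool.or_eq_true] at h ⊢
    exact h.imp (h₁ u w) (h₂ u w)
  | join i j e ih =>
    intro u w h
    have := ih u w
    simp only [CW.sem, Bool.or_eq_true, Bool.and_eq_true, decide_eq_true_eq] at h ⊢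
    rcases h with h | ⟨⟨⟨h1, h2⟩, h3⟩, h4⟩
    · exact Or.inl (this h)
    · exact Or.inr ⟨⟨⟨h2, h1⟩, h3.symm⟩, h4.symm.imp And.symm And.symm⟩
  | relabel i j e ih => exact ih

theorem CW.Sub.wf_irred {e e' : CW V k} (h : CW.Sub e e') :
    e'.wf → e'.irred → e.wf ∧ e.irred := by
  induction h with
  | refl e => exact fun a b => ⟨a, b⟩
  | unionL e₂ _ ih => exact fun a b => ih a.1 b.1
  | unionR e₁ _ ih => exact fun a b => ih a.2.1 b.2
  | join i j _ ih => exact fun a b => ih a.2 b.1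
  | relabel i j _ ih => exact fun a b => ih a.2.2 b

theorem join_count (e : CW V k) (i j : Fin k) (hij : i ≠ j) (c : V → Fin q) (a : Fin q)
    (hirr : ∀ u w, e.sem.adj u w = true → ¬(e.sem.lab u = i ∧ e.sem.lab w = j))
    (v : V) (hv : v ∈ e.sem.verts) :
    (e.sem.verts.filter fun u => (CW.join i j e).sem.adj v u = true ∧ c u = a).card =
      (e.sem.verts.filter fun u => e.sem.adj v u = true ∧ c u = a).card +
      (if e.sem.lab v = i then (e.sem.verts.filter fun u => c u = a ∧ e.sem.lab u = j).card
       else if e.sem.lab v = j then (e.sem.verts.filter fun u => c u = a ∧ e.sem.lab u = i).card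
       else 0) := by
  have hs := e.adj_symm
  split_ifs with h1 h2
  · rw [← Finset.card_union_of_disjoint]
    · congr 1
      ext u
      simp only [CW.sem, Bool.or_eq_true, Bool.and_eq_true, decide_eq_true_eq, Finset.mem_filter,
        Finset.mem_union]
      grind
    · rw [Finset.disjoint_left]
      intro u
      simp only [Finset.mem_filter]
      grind
  · rw [← Finset.card_union_of_disjoint]
    · congr 1
      ext u
      simp only [CW.sem, Bool.or_eq_true, Bool.and_eq_true, decide_eq_true_eq, Finset.mem_filter,
        Finset.mem_union]
      grind
    · rw [Finset.disjoint_left]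
      intro u
      simp only [Finset.mem_filter]
      grind
  · rw [add_zero]
    congr 1
    ext u
    simp only [CW.sem, Bool.or_eq_true, Bool.and_eq_true, decide_eq_true_eq, Finset.mem_filter]
    grind

/-- join `η_{i,j}(e)`, `e_G` irredundant. With `N_e[i,a] = min(𝓝, N[i,a]+C[j,a])`,
`N_e[j,a] = min(𝓝, N[j,a]+C[i,a])` and `N_e[h,a] = N[h,a]` for `h ∉ {i,j}`, we have
`λ(η_{i,j}(e), C, N) = λ(e, C, N_e)`. -/
theorem statement3 (P : LCP V q W) (eG : CW V k) (hwf : eG.wf) (hirr : eG.irred)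
    (𝓝 : ℕ) (h𝓝₁ : 1 ≤ 𝓝) (h𝓝₂ : 𝓝 ≤ eG.sem.verts.card)
    (hstable : ∀ (v : V) (a : Fin q) (n : Fin q → ℕ),
      P.check v a n = P.check v a fun j => min 𝓝 (n j))
    (i j : Fin k) (e : CW V k) (hsub : CW.Sub (.join i j e) eG)
    (C N Ne : Mat k q 𝓝)
    (hNei : ∀ a : Fin q, (Ne i a : ℕ) = min 𝓝 ((N i a : ℕ) + (C j a : ℕ)))
    (hNej : ∀ a : Fin q, (Ne j a : ℕ) = min 𝓝 ((N j a : ℕ) + (C i a : ℕ)))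
    (hNeh : ∀ (h : Fin k) (a : Fin q), h ≠ i → h ≠ j → Ne h a = N h a) :
    lambda P 𝓝 (.join i j e) C N = lambda P 𝓝 e C Ne := by
  obtain ⟨⟨hij, _⟩, _, hirr'⟩ := hsub.wf_irred hwf hirr
  have key : ∀ c : V → Fin q, IsCN P 𝓝 (.join i j e) C N c ↔ IsCN P 𝓝 e C Ne c := by
    intro c
    refine and_congr Iff.rfl (and_congr_right fun hC => ?_)
    change ∀ (i : Fin k) (a : Fin q),
      min 𝓝 (e.sem.verts.filter fun v => c v = a ∧ e.sem.lab v = i).card = (C i a : ℕ) at hC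
    refine forall_congr' fun v => forall_congr' fun hv => ?_
    change v ∈ e.sem.verts at hv
    refine Eq.congr (congrArg _ (funext fun a => ?_)) rfl
    change min 𝓝 ((N (e.sem.lab v) a : ℕ) +
      (e.sem.verts.filter fun u => (CW.join i j e).sem.adj v u = true ∧ c u = a).card) = _
    rw [join_count e i j hij c a hirr' v hv]
    have hi := hC i a
    have hj := hC j a
    split_ifs with h1 h2
    · rw [h1, hNei, ← hj]; omega
    · rw [h2, hNej, ← hi]; omega
    · rw [hNeh _ _ h1 h2, add_zero]
  unfold lambda
  simp only [key]
  rfl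
end
end

section
/- Suppose e_G is an irredundant clique-width k-expression. Let η_{i,j}(e) be a subexpression of e_G and let C, N ∈ {0,...,𝒩}^{k×q}. Let N_e ∈ {0,...,𝒩}^{k×q} be defined by: N_e[i,a] = min(𝒩, N[i,a] + C[j,a]) for every a ∈ Colors; N_e[j,a] = min(𝒩, N[j,a] + C[i,a]) for every a ∈ Colors; and N_e[h,a] = N[h,a] for every h ∈ {1,...,k} ∖ {i,j} and every a ∈ Colors. Then, noting that V(G_{η_{i,j}(e)}) = V(G_e) and that the labelings of G_{η_{i,j}(e)} and G_e coincide, a valid coloring c of this common vertex set is a (C,N)-coloring of G_{η_{i,j}(e)} if and only if c is a (C,N_e)-coloring of G_e. -/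
open Finset
open scoped Classical

noncomputable section

variable {V : Type} [Fintype V] [DecidableEq V] {k : ℕ}

variable {W : Type} [LinearOrder W] {q : ℕ}

theorem CW.join_card (i j : Fin k) (hij : i ≠ j) (e : CW V k)
    (hirr : ∀ u w, e.sem.adj u w = true → ¬(e.sem.lab u = i ∧ e.sem.lab w = j))
    (c : V → Fin q) (v : V) (hv : v ∈ e.sem.verts) (a : Fin q) :
    ((CW.join i j e).sem.verts.filter
        fun u => (CW.join i j e).sem.adj v u = true ∧ c u = a).card =
      (e.sem.verts.filter fun u => e.sem.adj v u = true ∧ c u = a).card +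
      (if e.sem.lab v = i then (e.sem.verts.filter fun u => c u = a ∧ e.sem.lab u = j).card
       else if e.sem.lab v = j then
        (e.sem.verts.filter fun u => c u = a ∧ e.sem.lab u = i).card
       else 0) := by
  have key : ∀ l m : Fin k, l ≠ m → e.sem.lab v = l →
      (∀ u, e.sem.adj v u = true → e.sem.lab u ≠ m) →
      (∀ u ∈ e.sem.verts, (CW.join i j e).sem.adj v u = true ↔
        (e.sem.adj v u = true ∨ e.sem.lab u = m)) →
      ((CW.join i j e).sem.verts.filter
        fun u => (CW.join i j e).sem.adj v u = true ∧ c u = a).card =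
      (e.sem.verts.filter fun u => e.sem.adj v u = true ∧ c u = a).card +
      (e.sem.verts.filter fun u => c u = a ∧ e.sem.lab u = m).card := by
    intro l m hlm hl hd hadj
    rw [← Finset.card_union_of_disjoint]
    · congr 1
      ext u
      simp only [Finset.mem_filter, Finset.mem_union]
      change u ∈ e.sem.verts ∧ _ ↔ _
      have := hadj u
      tauto
    · rw [Finset.disjoint_left]
      intro u hu hu'
      simp only [Finset.mem_filter] at hu hu'
      exact hd u hu.2.1 hu'.2.2
  split_ifs with h1 h2
  · apply key i j hij h1
    · intro u hu hj
      exact hirr v u hu ⟨h1, hj⟩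
    · intro u hu
      simp only [CW.sem, Bool.or_eq_true, Bool.and_eq_true, decide_eq_true_eq]
      have : e.sem.lab u = j → v ≠ u := by
        rintro h rfl; exact hij (h1.symm.trans h)
      have : e.sem.lab v ≠ j := fun h => hij (h1.symm.trans h)
      tauto
  · apply key j i hij.symm h2
    · intro u hu hi
      exact hirr u v (e.adj_symm _ _ hu) ⟨hi, h2⟩
    · intro u hu
      simp only [CW.sem, Bool.or_eq_true, Bool.and_eq_true, decide_eq_true_eq]
      have : e.sem.lab u = i → v ≠ u := by
        rintro h rfl; exact h1 h
      tauto
  · rw [Nat.add_zero]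
    congr 1
    ext u
    simp only [Finset.mem_filter, CW.sem, Bool.or_eq_true, Bool.and_eq_true, decide_eq_true_eq]
    tauto

/-- join `η_{i,j}(e)`, `e_G` irredundant, coloring version. With `N_e` as in
Statement 3, a valid coloring `c` of the common vertex set of `G_{η_{i,j}(e)}` and `G_e`
is a `(C,N)`-coloring of `G_{η_{i,j}(e)}` if and only if it is a `(C,N_e)`-coloring of `G_e`. -/
theorem statement4 (P : LCP V q W) (eG : CW V k) (hwf : eG.wf) (hirr : eG.irred)
    (𝓝 : ℕ) (h𝓝₁ : 1 ≤ 𝓝) (h𝓝₂ : 𝓝 ≤ eG.sem.verts.card)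
    (hstable : ∀ (v : V) (a : Fin q) (n : Fin q → ℕ),
      P.check v a n = P.check v a fun j => min 𝓝 (n j))
    (i j : Fin k) (e : CW V k) (hsub : CW.Sub (.join i j e) eG)
    (C N Ne : Mat k q 𝓝)
    (hNei : ∀ a : Fin q, (Ne i a : ℕ) = min 𝓝 ((N i a : ℕ) + (C j a : ℕ)))
    (hNej : ∀ a : Fin q, (Ne j a : ℕ) = min 𝓝 ((N j a : ℕ) + (C i a : ℕ)))
    (hNeh : ∀ (h : Fin k) (a : Fin q), h ≠ i → h ≠ j → Ne h a = N h a) :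
    ∀ c : V → Fin q, (∀ v ∈ (CW.join i j e).sem.verts, c v ∈ P.L v) →
      (IsCN P 𝓝 (.join i j e) C N c ↔ IsCN P 𝓝 e C Ne c) := by
  intro c _
  obtain ⟨⟨hij, -⟩, -, hir⟩ := hsub.wf_irred hwf hirr
  unfold IsCN
  refine and_congr Iff.rfl (and_congr_right fun hC => ?_)
  refine forall₂_congr fun v hv => ?_
  have hv' : v ∈ e.sem.verts := hv
  have hC' : ∀ (i : Fin k) (a : Fin q),
    min 𝓝 (e.sem.verts.filter fun v => c v = a ∧ e.sem.lab v = i).card = (C i a : ℕ) := hC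
  suffices H : ∀ a : Fin q,
      min 𝓝 ((N (e.sem.lab v) a : ℕ) + ((CW.join i j e).sem.verts.filter
        fun u => (CW.join i j e).sem.adj v u = true ∧ c u = a).card) =
      min 𝓝 ((Ne (e.sem.lab v) a : ℕ) +
        (e.sem.verts.filter fun u => e.sem.adj v u = true ∧ c u = a).card) by
    rw [← funext H]
    exact Iff.rfl
  intro a
  rw [CW.join_card i j hij e hir c v hv' a]
  split_ifs with h1 h2
  · have := hC' j a
    rw [h1, hNei a]
    omega
  · have := hC' i a
    rw [h2, hNej a]
    omega
  · rw [hNeh _ a h1 h2]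
    rfl
end
end

section
/- Let ρ_{i→j}(e), with i ≠ j, be a subexpression of e_G and let C, N ∈ {0,...,𝒩}^{k×q}. Let N_e ∈ {0,...,𝒩}^{k×q} be defined by N_e[i,a] = N[j,a] for every a ∈ Colors and N_e[h,a] = N[h,a] for every h ∈ {1,...,k} ∖ {i} and every a ∈ Colors. If C[i,a] = 0 for all a ∈ Colors, then λ(ρ_{i→j}(e), C, N) equals the minimum of λ(e, C_e, N_e) over all matrices C_e ∈ {0,...,𝒩}^{k×q} such that C[j,a] = min(𝒩, C_e[i,a] + C_e[j,a]) for all a ∈ Colors and C_e[h,a] = C[h,a] for all h ∈ {1,...,k} ∖ {i,j} and a ∈ Colors. Otherwise, λ(ρ_{i→j}(e), C, N) = Error. -/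
open Finset
open scoped Classical

noncomputable section

variable {V : Type} [Fintype V] [DecidableEq V] {k : ℕ}

variable {W : Type} [LinearOrder W] {q : ℕ}

theorem le_finMin_iff {α : Type} (S : Finset α) (f : α → W) (d x : W) (hd : ∀ s : W, s ≤ d) :
    x ≤ finMin S f d ↔ ∀ s ∈ S, x ≤ f s := by
  unfold finMin
  split_ifs with h
  · exact Finset.le_inf'_iff h f
  · rw [Finset.not_nonempty_iff_eq_empty] at h
    simp [h, hd]

theorem le_lambda_iff (P : LCP V q W) (𝓝 : ℕ) (e : CW V k) (C N : Mat k q 𝓝) (x : W) :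
    x ≤ lambda P 𝓝 e C N ↔ ∀ c, IsCN P 𝓝 e C N c → x ≤ P.weight e.sem.verts c := by
  unfold lambda
  rw [le_finMin_iff _ _ _ _ P.le_err]
  simp

/-- Number of vertices of color `a` and label `h`. -/
def cnt (e : CW V k) (c : V → Fin q) (h : Fin k) (a : Fin q) : ℕ :=
  (e.sem.verts.filter fun v => c v = a ∧ e.sem.lab v = h).card

theorem cnt_relabel_i (e : CW V k) (c : V → Fin q) (i j : Fin k) (hij : i ≠ j) (a : Fin q) :
    cnt (.relabel i j e) c i a = 0 := by
  unfold cnt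
  rw [Finset.card_eq_zero, Finset.filter_eq_empty_iff]
  intro v _ hv
  have := hv.2
  simp only [CW.sem] at this
  split_ifs at this with h
  · exact hij this.symm
  · exact h this

theorem cnt_relabel_j (e : CW V k) (c : V → Fin q) (i j : Fin k) (hij : i ≠ j) (a : Fin q) :
    cnt (.relabel i j e) c j a = cnt e c i a + cnt e c j a := by
  unfold cnt
  rw [← Finset.card_union_of_disjoint]
  · congr 1
    ext v
    simp only [Finset.mem_filter, Finset.mem_union]
    simp only [CW.sem]
    split_ifs with h
    · simp [h, hij]
    · simp [h]
  · rw [Finset.disjoint_left]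
    intro v h1 h2
    simp only [Finset.mem_filter] at h1 h2
    exact hij (h1.2.2.symm.trans h2.2.2)

theorem cnt_relabel_h (e : CW V k) (c : V → Fin q) (i j h : Fin k) (hi : h ≠ i) (hj : h ≠ j)
    (a : Fin q) : cnt (.relabel i j e) c h a = cnt e c h a := by
  unfold cnt
  congr 1
  ext v
  simp only [Finset.mem_filter]
  simp only [CW.sem]
  split_ifs with h'
  · simp [h', hi.symm, hj.symm]
  · rfl

theorem isCN_relabel_iff (P : LCP V q W) (𝓝 : ℕ) (i j : Fin k) (hij : i ≠ j) (e : CW V k)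
    (C N Ne : Mat k q 𝓝)
    (hNei : ∀ a : Fin q, Ne i a = N j a)
    (hNeh : ∀ (h : Fin k) (a : Fin q), h ≠ i → Ne h a = N h a) (c : V → Fin q) :
    IsCN P 𝓝 (.relabel i j e) C N c ↔
      (∀ a : Fin q, (C i a : ℕ) = 0) ∧ ∃ Ce : Mat k q 𝓝,
        ((∀ a : Fin q, (C j a : ℕ) = min 𝓝 ((Ce i a : ℕ) + (Ce j a : ℕ))) ∧
            (∀ (h : Fin k) (a : Fin q), h ≠ i → h ≠ j → Ce h a = C h a)) ∧
        IsCN P 𝓝 e Ce Ne c := by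
  have hN : ∀ v a, N ((CW.relabel i j e).sem.lab v) a = Ne (e.sem.lab v) a := by
    intro v a
    simp only [CW.sem]
    split_ifs with h
    · rw [h, hNei]
    · rw [hNeh _ _ h]
  constructor
  · rintro ⟨h1, h2, h3⟩
    change ∀ h a, min 𝓝 (cnt (.relabel i j e) c h a) = (C h a : ℕ) at h2
    refine ⟨fun a => by rw [← h2, cnt_relabel_i e c i j hij]; simp,
      fun h a => ⟨min 𝓝 (cnt e c h a), by omega⟩, ⟨fun a => ?_, fun h a hi hj => ?_⟩,
      h1, fun h a => rfl, fun v hv => ?_⟩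
    · rw [← h2, cnt_relabel_j e c i j hij]
      simp only
      omega
    · apply Fin.ext
      rw [← h2, cnt_relabel_h e c i j h hi hj]
    · have := h3 v hv
      simp only [hN] at this
      exact this
  · rintro ⟨h0, Ce, ⟨hj, hh⟩, h1, h2, h3⟩
    change ∀ h a, min 𝓝 (cnt e c h a) = (Ce h a : ℕ) at h2
    refine ⟨h1, ?_, fun v hv => ?_⟩
    · change ∀ h a, min 𝓝 (cnt (.relabel i j e) c h a) = (C h a : ℕ)
      intro h a
      by_cases hi : h = i
      · subst hi
        rw [h0, cnt_relabel_i e c h j hij]; simp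
      by_cases hj' : h = j
      · subst hj'
        rw [hj, cnt_relabel_j e c i h hij, ← h2, ← h2]
        omega
      · rw [cnt_relabel_h e c i j h hi hj', h2, hh h a hi hj']
    · simp only [hN]
      exact h3 v hv

/-- relabeling `ρ_{i→j}(e)`, `i ≠ j`. With `N_e[i,a] = N[j,a]` and
`N_e[h,a] = N[h,a]` for `h ≠ i`: if `C[i,a] = 0` for all colors `a`, then
`λ(ρ_{i→j}(e), C, N)` is the minimum of `λ(e, C_e, N_e)` over all `C_e ∈ {0,...,𝓝}^{k×q}`
with `C[j,a] = min(𝓝, C_e[i,a] + C_e[j,a])` for all `a` and `C_e[h,a] = C[h,a]` for all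
`h ∉ {i,j}` and `a`; otherwise `λ(ρ_{i→j}(e), C, N) = Error`. -/
theorem statement5 (P : LCP V q W) (eG : CW V k) (hwf : eG.wf)
    (𝓝 : ℕ) (h𝓝₁ : 1 ≤ 𝓝) (h𝓝₂ : 𝓝 ≤ eG.sem.verts.card)
    (hstable : ∀ (v : V) (a : Fin q) (n : Fin q → ℕ),
      P.check v a n = P.check v a fun j => min 𝓝 (n j))
    (i j : Fin k) (hij : i ≠ j) (e : CW V k) (hsub : CW.Sub (.relabel i j e) eG)
    (C N Ne : Mat k q 𝓝)
    (hNei : ∀ a : Fin q, Ne i a = N j a)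
    (hNeh : ∀ (h : Fin k) (a : Fin q), h ≠ i → Ne h a = N h a) :
    ((∀ a : Fin q, (C i a : ℕ) = 0) →
      lambda P 𝓝 (.relabel i j e) C N =
        finMin (univ.filter fun Ce : Mat k q 𝓝 =>
            (∀ a : Fin q, (C j a : ℕ) = min 𝓝 ((Ce i a : ℕ) + (Ce j a : ℕ))) ∧
            (∀ (h : Fin k) (a : Fin q), h ≠ i → h ≠ j → Ce h a = C h a))
          (fun Ce => lambda P 𝓝 e Ce Ne) P.err) ∧
    ((¬∀ a : Fin q, (C i a : ℕ) = 0) →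
      lambda P 𝓝 (.relabel i j e) C N = P.err) := by
  have key := isCN_relabel_iff P 𝓝 i j hij e C N Ne hNei hNeh
  constructor
  · intro h0
    refine eq_of_forall_le_iff fun x => ?_
    rw [le_lambda_iff, le_finMin_iff _ _ _ _ P.le_err]
    simp only [le_lambda_iff, Finset.mem_filter, Finset.mem_univ, true_and]
    constructor
    · intro H Ce hCe c hc
      exact H c ((key c).2 ⟨h0, Ce, hCe, hc⟩)
    · intro H c hc
      obtain ⟨_, Ce, hCe, hc'⟩ := (key c).1 hc
      exact H Ce hCe c hc'
  · intro h0
    refine le_antisymm (P.le_err _) ?_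
    rw [le_lambda_iff]
    intro c hc
    exact absurd ((key c).1 hc).1 h0
end
end

section
/- Let i(v) be a subexpression of e_G (creating the new vertex v with label i), let C, N ∈ {0,...,𝒩}^{k×q} with 𝒩 ≥ 1, let p̂ be a tuple of additional parameters, and let a ∈ Colors, s_a ∈ Q, f_a : Q → {True, False}. Assume that every (C,N,p̂)-coloring of G_{i(v)} is in particular a (C,N)-coloring of G_{i(v)}, i.e. it satisfies min(𝒩, |{u ∈ V(G_{i(v)}) : c(u) = b ∧ ℓ_{i(v)}(u) = j}|) = C[j,b] for all labels j and colors b. If either C[i,a] = 1 and f_a(δ(s_a, 1)) = True, or C[i,a] = 0 and f_a(s_a) = True, then λ(i(v), C, N, p̂, s_a, f_a) = λ(i(v), C, N, p̂). Otherwise, λ(i(v), C, N, p̂, s_a, f_a) = Error. -/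
open Finset
open scoped Classical

noncomputable section

variable {V : Type} [Fintype V] [DecidableEq V] {k : ℕ}

variable {W : Type} [LinearOrder W] {q : ℕ}

variable {Pt Q : Type}

/-- `λ(e,C,N,p̂)` for an abstract family `Col` of `(C,N,p̂)`-colorings of the graphs `G_e`:
the minimum weight of a `(C,N,p̂)`-coloring of `G_e`, `Error` if none exists. -/
def lambdaA (P : LCP V q W) {𝓝 : ℕ}
    (Col : CW V k → Mat k q 𝓝 → Mat k q 𝓝 → Pt → (V → Fin q) → Prop)
    (e : CW V k) (C N : Mat k q 𝓝) (p : Pt) : W :=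
  finMin (univ.filter fun c : V → Fin q => Col e C N p c) (P.weight e.sem.verts) P.err

/-- `c` is a `(C,N,p̂,s_a,f_a)`-coloring of `G_e`: a `(C,N,p̂)`-coloring of `G_e` such that
`f_a (δ^n (s_a)) = true`, where `n = |{v ∈ V(G_e) : c v = a}|` and `δ` is the transition
function of a deterministic finite-state automaton over the one-letter alphabet `{1}`. -/
def ColS {𝓝 : ℕ}
    (Col : CW V k → Mat k q 𝓝 → Mat k q 𝓝 → Pt → (V → Fin q) → Prop)
    (δ : Q → Q) (a : Fin q) (e : CW V k) (C N : Mat k q 𝓝) (p : Pt)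
    (s : Q) (f : Q → Bool) (c : V → Fin q) : Prop :=
  Col e C N p c ∧ f (δ^[(e.sem.verts.filter fun v => c v = a).card] s) = true

/-- `λ(e,C,N,p̂,s_a,f_a)`: minimum weight of a `(C,N,p̂,s_a,f_a)`-coloring of `G_e`,
`Error` if none exists. -/
def lambdaS (P : LCP V q W) {𝓝 : ℕ}
    (Col : CW V k → Mat k q 𝓝 → Mat k q 𝓝 → Pt → (V → Fin q) → Prop)
    (δ : Q → Q) (a : Fin q) (e : CW V k) (C N : Mat k q 𝓝) (p : Pt)
    (s : Q) (f : Q → Bool) : W :=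
  finMin (univ.filter fun c : V → Fin q => ColS Col δ a e C N p s f c)
    (P.weight e.sem.verts) P.err

/-- The coloring `c₁ ∪ c₂` agreeing with `c₁` on `S` and with `c₂` elsewhere. -/
def glueOn (S : Finset V) (c₁ c₂ : V → Fin q) : V → Fin q :=
  fun v => if v ∈ S then c₁ v else c₂ v

/-- creating a new vertex `i(v)`, with a size parameter. If `C[i,a] = 1` and
`f_a(δ(s_a,1))` is true, or `C[i,a] = 0` and `f_a(s_a)` is true, then
`λ(i(v), C, N, p̂, s_a, f_a) = λ(i(v), C, N, p̂)`; otherwise it equals `Error`. -/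
theorem statement7 (P : LCP V q W) (𝓝 : ℕ) (h𝓝 : 1 ≤ 𝓝)
    (Col : CW V k → Mat k q 𝓝 → Mat k q 𝓝 → Pt → (V → Fin q) → Prop)
    (hvalid : ∀ (e : CW V k) (C N : Mat k q 𝓝) (p : Pt) (c : V → Fin q),
      Col e C N p c → ∀ v ∈ e.sem.verts, c v ∈ P.L v)
    (eG : CW V k) (i : Fin k) (v : V) (hsub : CW.Sub (.node i v) eG)
    (C N : Mat k q 𝓝) (p : Pt)
    (δ : Q → Q) (a : Fin q) (s : Q) (f : Q → Bool)
    (hC1 : ∀ c : V → Fin q, Col (.node i v) C N p c →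
      ∀ (j : Fin k) (b : Fin q),
        min 𝓝 (((CW.node i v : CW V k).sem.verts.filter fun u =>
            c u = b ∧ (CW.node i v : CW V k).sem.lab u = j).card) = (C j b : ℕ)) :
    ((((C i a : ℕ) = 1 ∧ f (δ s) = true) ∨ ((C i a : ℕ) = 0 ∧ f s = true)) →
      lambdaS P Col δ a (.node i v) C N p s f = lambdaA P Col (.node i v) C N p) ∧
    (¬(((C i a : ℕ) = 1 ∧ f (δ s) = true) ∨ ((C i a : ℕ) = 0 ∧ f s = true)) →
      lambdaS P Col δ a (.node i v) C N p s f = P.err) := by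
  have key : ∀ c : V → Fin q, Col (.node i v) C N p c →
      ((CW.node i v : CW V k).sem.verts.filter fun u => c u = a).card = (C i a : ℕ) ∧
        ((C i a : ℕ) = 0 ∨ (C i a : ℕ) = 1) := by
    intro c hc
    have h := hC1 c hc i a
    have e1 : ((CW.node i v : CW V k).sem.verts.filter fun u =>
        c u = a ∧ (CW.node i v : CW V k).sem.lab u = i) =
        ((CW.node i v : CW V k).sem.verts.filter fun u => c u = a) := by
      apply Finset.filter_congr
      intro u _
      simp [CW.sem]
    have h2 : ((CW.node i v : CW V k).sem.verts.filter fun u => c u = a).card ≤ 1 := by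
      refine (Finset.card_filter_le _ _).trans ?_
      simp [CW.sem]
    rw [e1] at h
    omega
  constructor
  · intro h
    unfold lambdaS lambdaA
    congr 1
    apply Finset.filter_congr
    intro c _
    unfold ColS
    constructor
    · exact fun hc => hc.1
    · intro hc
      refine ⟨hc, ?_⟩
      rw [(key c hc).1]
      rcases h with ⟨h1, h2⟩ | ⟨h1, h2⟩ <;> rw [h1] <;> simpa using h2
  · intro h
    unfold lambdaS finMin
    rw [dif_neg]
    rintro ⟨c, hc⟩
    obtain ⟨hc, hf⟩ := (Finset.mem_filter.1 hc).2
    obtain ⟨h1, h2⟩ := key c hc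
    rw [h1] at hf
    apply h
    rcases h2 with h2 | h2
    · right
      refine ⟨h2, ?_⟩
      rw [h2] at hf
      simpa using hf
    · left
      refine ⟨h2, ?_⟩
      rw [h2] at hf
      simpa using hf
end
end

section
/- Let k ≥ 1 be an integer. For every a ∈ {0,1,...,k+1} and all non-negative integers n_0, n_1, ..., n_{k+1}: a + Σ_{j=0}^{k+1} j·n_j ≥ k + Σ_{j=1}^{k+1} n_j holds if and only if a + Σ_{j=0}^{k+1} j·min(k+1, n_j) ≥ k + Σ_{j=1}^{k+1} min(k+1, n_j) holds. In other words, the check function of the [k]-Roman domination problem, check(v, a, n_0, ..., n_{k+1}) = (a + Σ_{j=0}^{k+1} j·n_j ≥ k + Σ_{j=1}^{k+1} n_j), is (k+1)-stable. -/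
open Finset

theorem check_reduce (k a : ℕ) (m : ℕ → ℕ) :
    (a + ∑ j ∈ Finset.range (k + 2), j * m j ≥ k + ∑ j ∈ Finset.Icc 1 (k + 1), m j) ↔
      k ≤ a + ∑ j ∈ Finset.range (k + 1), j * m (j + 1) := by
  have h1 : ∑ j ∈ Finset.range (k + 2), j * m j =
      ∑ j ∈ Finset.range (k + 1), j * m (j + 1) + ∑ j ∈ Finset.range (k + 1), m (j + 1) := by
    rw [Finset.sum_range_succ', ← Finset.sum_add_distrib]
    simp [add_mul]
  have h2 : ∑ j ∈ Finset.Icc 1 (k + 1), m j = ∑ j ∈ Finset.range (k + 1), m (j + 1) := by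
    rw [Finset.range_eq_Ico, Finset.sum_Ico_add' m 0 (k + 1) 1]
    rfl
  rw [h1, h2]
  omega

/-- The check function of the `[k]`-Roman domination problem,
`check(v, a, n_0, ..., n_{k+1}) = (a + ∑_{j=0}^{k+1} j·n_j ≥ k + ∑_{j=1}^{k+1} n_j)`,
is `(k+1)`-stable: for every color `a ∈ {0,...,k+1}` and all non-negative integers
`n_0, ..., n_{k+1}`, the inequality holds iff it holds with each `n_j` replaced by
`min (k+1) n_j`. -/
theorem statement12 (k : ℕ) (hk : 1 ≤ k) (a : ℕ) (ha : a ≤ k + 1) (n : ℕ → ℕ) :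
    (a + ∑ j ∈ Finset.range (k + 2), j * n j ≥
        k + ∑ j ∈ Finset.Icc 1 (k + 1), n j) ↔
      (a + ∑ j ∈ Finset.range (k + 2), j * min (k + 1) (n j) ≥
        k + ∑ j ∈ Finset.Icc 1 (k + 1), min (k + 1) (n j)) := by
  rw [check_reduce k a n, check_reduce k a (fun j => min (k + 1) (n j))]
  constructor
  · intro h
    by_cases hb : ∃ j ∈ Finset.range (k + 1), 1 ≤ j ∧ k + 1 ≤ n (j + 1)
    · obtain ⟨j, hj, hj1, hn⟩ := hb
      have h3 := Finset.single_le_sum (f := fun j => j * min (k + 1) (n (j + 1)))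
        (fun i _ => Nat.zero_le _) hj
      simp only [min_eq_left hn] at h3
      have h4 : 1 * (k + 1) ≤ j * (k + 1) := Nat.mul_le_mul_right _ hj1
      omega
    · push Not at hb
      have h3 : ∑ j ∈ Finset.range (k + 1), j * min (k + 1) (n (j + 1)) =
          ∑ j ∈ Finset.range (k + 1), j * n (j + 1) := by
        refine Finset.sum_congr rfl fun j hj => ?_
        rcases Nat.eq_zero_or_pos j with h0 | h0
        · simp [h0]
        · rw [min_eq_right (hb j hj h0).le]
      rw [h3]
      exact h
  · intro h
    refine h.trans (Nat.add_le_add_left (Finset.sum_le_sum fun j _ => ?_) a)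
    exact Nat.mul_le_mul_left _ (min_le_right _ _)
end
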